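/- arXiv:1409.7261 — 8 statements merged into one kernel-verified Lean document; each statement's English description precedes it below -/
import Mathlib

section
/- Let V be a finite set, let E_1, …, E_m be subsets of V, let ℓ ≥ 2 be an integer, and let φ : V → {1,…,ℓ} be a coloring with color classes V_j = φ⁻¹(j), each nonempty and pairwise disjoint. Let P : V × V × V → Prop be a predicate such that: P(a,b,c) holds whenever a = b and a ≠ c; P(a,b,c) holds whenever a = c and a ≠ b; and P(a,b,c) fails whenever a, b, c are pairwise distinct. Then the following are equivalent: (1) there exist functions σ : {1,…,ℓ} → V and e : {1,…,m} × {2,…,ℓ} → V such that σ(j) ∈ V_j for every j, e(i,ℓ) ∈ E_i for every i, P(e(i,2), σ(1), σ(2)) holds for every i ∈ {1,…,m}, and P(e(i,j), e(i,j−1), σ(j)) holds for every i ∈ {1,…,m} and every j with 3 ≤ j ≤ ℓ; (2) there exist v_1, …, v_ℓ with v_j ∈ V_j for every j such that {v_1,…,v_ℓ} ∩ E_i ≠ ∅ for every i ∈ {1,…,m}. -/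
/-- Correctness of the reduction from Multi-colored Hitting Set (Lemma 3.2 of the paper).
`V` is the finite vertex/user set, `E i` (for `i ∈ {1,…,m}`) are the sets to be hit,
`φ` is a coloring with colors `{1,…,ℓ}` whose color classes `V_j = φ⁻¹(j)` are nonempty
(and automatically pairwise disjoint), and `P` is a ternary predicate satisfied whenever
exactly the first and second, or exactly the first and third, arguments coincide, and
violated whenever all three arguments are pairwise distinct. -/
theorem stmt_0 {V : Type*} [Fintype V] (m ℓ : ℕ) (hℓ : 2 ≤ ℓ)
    (E : ℕ → Set V) (φ : V → ℕ)
    (hφ : ∀ v : V, φ v ∈ Finset.Icc 1 ℓ)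
    (hne : ∀ j ∈ Finset.Icc 1 ℓ, ∃ v : V, φ v = j)
    (P : V → V → V → Prop)
    (hP1 : ∀ a b c : V, a = b → a ≠ c → P a b c)
    (hP2 : ∀ a b c : V, a = c → a ≠ b → P a b c)
    (hP3 : ∀ a b c : V, a ≠ b → a ≠ c → b ≠ c → ¬ P a b c) :
    (∃ (σ : ℕ → V) (e : ℕ → ℕ → V),
        (∀ j ∈ Finset.Icc 1 ℓ, φ (σ j) = j) ∧
        (∀ i ∈ Finset.Icc 1 m, e i ℓ ∈ E i) ∧
        (∀ i ∈ Finset.Icc 1 m, P (e i 2) (σ 1) (σ 2)) ∧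
        (∀ i ∈ Finset.Icc 1 m, ∀ j : ℕ, 3 ≤ j → j ≤ ℓ →
          P (e i j) (e i (j - 1)) (σ j))) ↔
      (∃ v : ℕ → V, (∀ j ∈ Finset.Icc 1 ℓ, φ (v j) = j) ∧
        ∀ i ∈ Finset.Icc 1 m, ∃ j ∈ Finset.Icc 1 ℓ, v j ∈ E i) := by
  have ne_of_colors {w : ℕ → V} (hw : ∀ j ∈ Finset.Icc 1 ℓ, φ (w j) = j) {j k : ℕ}
      (hj : 1 ≤ j) (hjk : j < k) (hk : k ≤ ℓ) : w j ≠ w k := by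
    intro h
    have hwj := hw j (Finset.mem_Icc.2 ⟨hj, by omega⟩)
    have hwk := hw k (Finset.mem_Icc.2 ⟨by omega, hk⟩)
    rw [h] at hwj
    omega
  have eq_or_eq {a b c : V} (hbc : b ≠ c) (h : P a b c) : a = b ∨ a = c := by
    by_contra! hne
    exact hP3 a b c hne.1 hne.2 hbc h
  constructor
  · rintro ⟨σ, e, hσ, hE, hbase, hstep⟩
    refine ⟨σ, hσ, fun i hi => ?_⟩
    have selected (j : ℕ) (hj : 2 ≤ j) : j ≤ ℓ → ∃ k, 1 ≤ k ∧ k ≤ j ∧ e i j = σ k := by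
      induction j, hj using Nat.le_induction with
      | base =>
        intro _
        rcases eq_or_eq (ne_of_colors hσ le_rfl one_lt_two hℓ) (hbase i hi) with h | h
        · exact ⟨1, le_rfl, one_le_two, h⟩
        · exact ⟨2, one_le_two, le_rfl, h⟩
      | succ j hj ih =>
        intro hjℓ
        obtain ⟨k, hk, hkj, hek⟩ := ih (by omega)
        have hP := hstep i hi (j + 1) (by omega) hjℓ
        rw [Nat.add_sub_cancel, hek] at hP
        rcases eq_or_eq (ne_of_colors hσ hk (by omega) hjℓ) hP with h | h
        · exact ⟨k, hk, by omega, h⟩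
        · exact ⟨j + 1, by omega, le_rfl, h⟩
    obtain ⟨k, hk, hkℓ, hek⟩ := selected ℓ hℓ le_rfl
    exact ⟨k, Finset.mem_Icc.2 ⟨hk, hkℓ⟩, hek ▸ hE i hi⟩
  · rintro ⟨v, hv, hhit⟩
    choose! t ht htE using hhit
    refine ⟨v, fun i j => if j < t i then v 1 else v (t i), hv, fun i hi => ?_, fun i hi => ?_,
      fun i hi j hj hjℓ => ?_⟩
    · have := Finset.mem_Icc.1 (ht i hi)
      simpa [this.2.not_gt] using htE i hi
    · have := Finset.mem_Icc.1 (ht i hi)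
      have hv12 : v 1 ≠ v 2 := ne_of_colors hv le_rfl one_lt_two hℓ
      dsimp only
      split_ifs with h
      · exact hP1 _ _ _ rfl hv12
      · obtain h1 | h2 : t i = 1 ∨ t i = 2 := by omega
        · rw [h1]
          exact hP1 _ _ _ rfl hv12
        · rw [h2]
          exact hP2 _ _ _ rfl hv12.symm
    · have := Finset.mem_Icc.1 (ht i hi)
      dsimp only
      rcases lt_trichotomy j (t i) with h | h | h
      · rw [if_pos h, if_pos (by omega)]
        exact hP1 _ _ _ rfl (ne_of_colors hv le_rfl (by omega) hjℓ)
      · rw [if_neg (by omega), if_pos (by omega), ← h]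
        exact hP2 _ _ _ rfl (ne_of_colors hv le_rfl (by omega) hjℓ).symm
      · rw [if_neg (by omega), if_neg (by omega)]
        exact hP1 _ _ _ rfl (ne_of_colors hv this.1 h hjℓ)
end

section
/- Let φ be a CNF formula over variables x_1, …, x_n, given as a finite set of clauses, where each clause c consists of a set c⁺ of positively occurring variable indices and a set c⁻ of negatively occurring variable indices. For each i ∈ {1,…,n} introduce two tasks p_i and q_i, and introduce one further task d; for each clause c let L_c = {p_i : i ∈ c⁺} ∪ {q_i : i ∈ c⁻} ∪ {d}. Then φ is satisfiable if and only if there exists an assignment π of one of two users {t, f} to every task such that: π(d) = f; π(p_i) ≠ π(q_i) for every i ∈ {1,…,n}; and for every clause c of φ, the tasks of L_c are assigned at least two distinct users, i.e., there exist x, y ∈ L_c with π(x) ≠ π(y). -/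
/-- The set of tasks `L_c` associated with a clause `c = (c⁺, c⁻)`: the tasks `p_i`
(encoded as `Sum.inl i`) for positively occurring variables `i ∈ c⁺`, the tasks `q_i`
(encoded as `Sum.inr (Sum.inl i)`) for negatively occurring variables `i ∈ c⁻`,
and the extra task `d` (encoded as `Sum.inr (Sum.inr ())`). -/
def clauseTasks (n : ℕ) (c : Finset (Fin n) × Finset (Fin n)) :
    Set (Fin n ⊕ Fin n ⊕ Unit) :=
  {z | (∃ i ∈ c.1, z = Sum.inl i) ∨ (∃ i ∈ c.2, z = Sum.inr (Sum.inl i)) ∨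
    z = Sum.inr (Sum.inr ())}

/-- If the task `d` is assigned the user `f`, then the tasks of a clause receive two distinct
users iff one of its tasks `p_i` or `q_i` is assigned the user `t`. -/
theorem exists_ne_clauseTasks_iff {n : ℕ} {π : (Fin n ⊕ Fin n ⊕ Unit) → Bool}
    (hd : π (Sum.inr (Sum.inr ())) = false) (c : Finset (Fin n) × Finset (Fin n)) :
    (∃ x ∈ clauseTasks n c, ∃ y ∈ clauseTasks n c, π x ≠ π y) ↔
      (∃ i ∈ c.1, π (Sum.inl i) = true) ∨ (∃ i ∈ c.2, π (Sum.inr (Sum.inl i)) = true) := by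
  constructor
  · rintro ⟨x, hx, y, hy, hxy⟩
    have of_true : ∀ z ∈ clauseTasks n c, π z = true →
        (∃ i ∈ c.1, π (Sum.inl i) = true) ∨ (∃ i ∈ c.2, π (Sum.inr (Sum.inl i)) = true) := by
      rintro z (⟨i, hi, rfl⟩ | ⟨i, hi, rfl⟩ | rfl) hz
      · exact Or.inl ⟨i, hi, hz⟩
      · exact Or.inr ⟨i, hi, hz⟩
      · simp [hd] at hz
    cases hπ : π x with
    | true => exact of_true x hx hπ
    | false => exact of_true y hy (by simpa [hπ] using hxy.symm)
  · rintro (⟨i, hi, h⟩ | ⟨i, hi, h⟩)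
    · exact ⟨_, Or.inl ⟨i, hi, rfl⟩, _, Or.inr (Or.inr rfl), by simp [h, hd]⟩
    · exact ⟨_, Or.inr (Or.inl ⟨i, hi, rfl⟩), _, Or.inr (Or.inr rfl), by simp [h, hd]⟩

/-- Correctness of the PPT from SAT(n) to WSP(≥2) (Lemma 3.1 of the paper).
A CNF formula over `n` variables, given as a finite set of clauses `c = (c⁺, c⁻)`,
is satisfiable iff there is an assignment `π` of the two users `{t, f}` (encoded as
`Bool`, with `t = true` and `f = false`) to the tasks `p_i, q_i, d` such that
`π(d) = f`, `π(p_i) ≠ π(q_i)` for all `i`, and each clause set `L_c` receives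
at least two distinct users. -/
theorem stmt_1 (n : ℕ) (clauses : Finset (Finset (Fin n) × Finset (Fin n))) :
    (∃ v : Fin n → Bool, ∀ c ∈ clauses,
        (∃ i ∈ c.1, v i = true) ∨ (∃ i ∈ c.2, v i = false)) ↔
      (∃ π : (Fin n ⊕ Fin n ⊕ Unit) → Bool,
        π (Sum.inr (Sum.inr ())) = false ∧
        (∀ i : Fin n, π (Sum.inl i) ≠ π (Sum.inr (Sum.inl i))) ∧
        (∀ c ∈ clauses, ∃ x ∈ clauseTasks n c, ∃ y ∈ clauseTasks n c, π x ≠ π y)) := by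
  constructor
  · rintro ⟨v, hv⟩
    refine ⟨Sum.elim v (Sum.elim (fun i => !v i) fun _ => false), rfl, fun i => by simp,
      fun c hc => (exists_ne_clauseTasks_iff rfl c).2 ?_⟩
    simpa using hv c hc
  · rintro ⟨π, hd, hne, hπ⟩
    refine ⟨fun i => π (Sum.inl i), fun c hc => ?_⟩
    refine ((exists_ne_clauseTasks_iff hd c).1 (hπ c hc)).imp_right ?_
    rintro ⟨i, hi, h⟩
    exact ⟨i, hi, by simpa [h] using hne i⟩
end

section
/- Let (S, U, A, C) be a workflow schema with S and U finite such that every constraint c ∈ C is regular and intersection-closed and, for every constraint c = (L, Θ) ∈ C and every s ∈ L, the singleton {s} is c-eligible. Suppose M ⊆ U, S_h ⊆ S, and g : S \ S_h → U is an injective function satisfying: A(s) ⊆ M for every s ∈ S_h; g(s) ∈ A(s) ∩ M for every s ∈ S \ S_h; and g(s) ∉ A(s') for every s ∈ S \ S_h and every s' ∈ S_h. Then the schema has a valid complete plan if and only if it has a valid complete plan π whose image is contained in M. -/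
namespace WSP

/-- A workflow constraint `c = (L, Θ)`: a scope `L ⊆ S` together with a set `Θ`
of functions `L → U` (the plans on `L` satisfying the constraint). -/
structure Constraint (S U : Type*) where
  scope : Set S
  theta : Set (scope → U)

/-- A set `T ⊆ L` is `c`-eligible if some `θ ∈ Θ` has `θ⁻¹(u) = T` for some user `u`. -/
def Eligible {S U : Type*} (c : Constraint S U) (T : Set c.scope) : Prop :=
  ∃ θ ∈ c.theta, ∃ u : U, θ ⁻¹' {u} = T

/-- A constraint is regular if for every partition `L_1, …, L_p` of its scope into
`c`-eligible (nonempty, pairwise disjoint, covering) blocks and every choice of pairwise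
distinct users `u_1, …, u_p`, the plan assigning every task of `L_i` to `u_i` lies in `Θ`. -/
def Regular {S U : Type*} (c : Constraint S U) : Prop :=
  ∀ (p : ℕ) (B : Fin p → Set c.scope) (u : Fin p → U) (π : c.scope → U),
    (∀ i, (B i).Nonempty) →
    (Pairwise fun i j => Disjoint (B i) (B j)) →
    (⋃ i, B i) = Set.univ →
    (∀ i, Eligible c (B i)) →
    Function.Injective u →
    (∀ i, ∀ x ∈ B i, π x = u i) →
    π ∈ c.theta

/-- A constraint is intersection-closed if the family of `c`-eligible sets, together
with `∅` by convention, is closed under pairwise intersection. -/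
def IntersectionClosed {S U : Type*} (c : Constraint S U) : Prop :=
  ∀ T₁ T₂ : Set c.scope, (T₁ = ∅ ∨ Eligible c T₁) → (T₂ = ∅ ∨ Eligible c T₂) →
    (T₁ ∩ T₂ = ∅ ∨ Eligible c (T₁ ∩ T₂))

/-- A complete plan `π : S → U` satisfies a constraint if its restriction to the scope
lies in `Θ`. -/
def Satisfies {S U : Type*} (π : S → U) (c : Constraint S U) : Prop :=
  (fun x : c.scope => π x) ∈ c.theta

/-- A complete plan is valid if it is authorized and satisfies every constraint. -/
def ValidPlan {S U : Type*} (A : S → Set U) (C : Set (Constraint S U)) (π : S → U) : Prop :=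
  (∀ s, π s ∈ A s) ∧ ∀ c ∈ C, Satisfies π c

/-- A plan on the scope of a regular constraint satisfies it as soon as every block of
tasks assigned to a common user is eligible. -/
theorem Regular.mem_theta {S U : Type*} [Finite S] {c : Constraint S U} (hc : Regular c)
    (θ : c.scope → U) (h : ∀ x, Eligible c (θ ⁻¹' {θ x})) : θ ∈ c.theta := by
  obtain ⟨p, ⟨e⟩⟩ := Finite.exists_equiv_fin (Set.range θ)
  refine hc p (fun i => θ ⁻¹' {(e.symm i : U)}) (fun i => e.symm i) θ ?_ ?_ ?_ ?_
    (Subtype.val_injective.comp e.symm.injective) fun _ _ hx => hx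
  · intro i
    obtain ⟨x, hx⟩ := (e.symm i).2
    exact ⟨x, hx⟩
  · intro i j hij
    refine Set.disjoint_left.2 fun x hi hj => hij ?_
    exact e.symm.injective (Subtype.ext (Eq.trans (Eq.symm hi) hj))
  · refine Set.eq_univ_of_forall fun x => Set.mem_iUnion.2 ⟨e ⟨θ x, x, rfl⟩, ?_⟩
    simp
  · intro i
    obtain ⟨x, hx⟩ := (e.symm i).2
    simpa only [hx] using h x

/-- Abstract content of Lemma 4.4 of the paper: in a workflow schema whose constraints
are all regular, intersection-closed, and have all singletons of their scopes eligible,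
given marked users `M`, hard tasks `Sh` (whose authorization lists lie inside `M`),
and a system of distinct representatives `g` for the easy tasks (with `g s ∈ A s ∩ M`,
`g` injective on the easy tasks, and `g s` not authorized for any hard task), the schema
has a valid complete plan iff it has one using only marked users. -/
theorem stmt_2 {S U : Type*} [Fintype S] [Fintype U]
    (A : S → Set U) (C : Set (Constraint S U))
    (hreg : ∀ c ∈ C, Regular c)
    (hic : ∀ c ∈ C, IntersectionClosed c)
    (hsing : ∀ c ∈ C, ∀ x : c.scope, Eligible c {x})
    (M : Set U) (Sh : Set S) (g : S → U)
    (hAh : ∀ s ∈ Sh, A s ⊆ M)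
    (hg1 : ∀ s ∉ Sh, g s ∈ A s ∩ M)
    (hg2 : ∀ s ∉ Sh, ∀ s' ∈ Sh, g s ∉ A s')
    (hginj : Set.InjOn g Shᶜ) :
    (∃ π : S → U, ValidPlan A C π) ↔
      (∃ π : S → U, ValidPlan A C π ∧ ∀ s, π s ∈ M) := by
  classical
  refine ⟨?_, fun ⟨π, hπ, _⟩ => ⟨π, hπ⟩⟩
  rintro ⟨π, hauth, hsat⟩
  -- Users performing a hard task keep all their tasks; every other task goes to `g`.
  let K : Set U := π '' Sh
  have hK : ∀ s, π s ∉ K → s ∉ Sh := fun s hs hmem => hs ⟨s, hmem, rfl⟩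
  have hgK : ∀ s, π s ∉ K → g s ∉ K := by
    rintro s hs ⟨t, ht, hts⟩
    exact hg2 s (hK s hs) t ht (hts ▸ hauth t)
  let ρ : S → U := fun s => if π s ∈ K then π s else g s
  have hρ_pos : ∀ s, π s ∈ K → ρ s = π s := fun s hs => if_pos hs
  have hρ_neg : ∀ s, π s ∉ K → ρ s = g s := fun s hs => if_neg hs
  refine ⟨ρ, ⟨fun s => ?_, fun c hc => (hreg c hc).mem_theta _ fun x => ?_⟩, fun s => ?_⟩
  · by_cases hs : π s ∈ K
    · exact hρ_pos s hs ▸ hauth s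
    · exact hρ_neg s hs ▸ (hg1 s (hK s hs)).1
  · by_cases hx : π x ∈ K
    · refine ⟨_, hsat c hc, π x, ?_⟩
      ext y
      by_cases hy : π y ∈ K
      · simp [hρ_pos _ hx, hρ_pos _ hy]
      · simp only [Set.mem_preimage, Set.mem_singleton_iff, hρ_pos _ hx, hρ_neg _ hy]
        exact ⟨fun h => absurd (h ▸ hx) hy, fun h => absurd (h ▸ hx) (hgK _ hy)⟩
    · convert hsing c hc x using 1
      ext y
      simp only [Set.mem_preimage, Set.mem_singleton_iff, hρ_neg _ hx]
      refine ⟨fun h => ?_, fun h => by rw [h, hρ_neg _ hx]⟩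
      by_cases hy : π y ∈ K
      · rw [hρ_pos _ hy] at h
        exact absurd (h ▸ hy) (hgK _ hx)
      · rw [hρ_neg _ hy] at h
        exact Subtype.ext (hginj (hK _ hy) (hK _ hx) h)
  · by_cases hs : π s ∈ K
    · obtain ⟨t, ht, hts⟩ := hs
      rw [hρ_pos s ⟨t, ht, hts⟩, ← hts]
      exact hAh t ht (hauth t)
    · exact hρ_neg s hs ▸ (hg1 s (hK s hs)).2

end WSP
end

section
/- Let (S, U, A, C) be a workflow schema containing two distinct tasks s, s' ∈ S and containing the equality constraint c_eq = ({s, s'}, Θ_eq) where Θ_eq consists of all functions θ : {s, s'} → U with θ(s) = θ(s'). Define the merged schema (S', U, A', C') by: S' = S \ {s'}; A'(s) = A(s) ∩ A(s') and A'(t) = A(t) for all t ∈ S' with t ≠ s; and C' obtained from C \ {c_eq} by replacing every constraint (L, Θ) by (ρ(L), Θ'), where ρ : S → S' maps s' to s and fixes all other tasks, and Θ' = {θ' : ρ(L) → U : θ' ∘ (ρ restricted to L) ∈ Θ}. Then (S, U, A, C) has a valid complete plan if and only if (S', U, A', C') has a valid complete plan. -/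
namespace WSP

open scoped Classical

/-- The equality constraint `c_eq = ({s, s'}, Θ_eq)` where `Θ_eq` consists of all
functions `θ : {s, s'} → U` with `θ(s) = θ(s')`. -/
def eqConstraint {S : Type*} (U : Type*) (s s' : S) : Constraint S U where
  scope := {s, s'}
  theta := {θ | θ ⟨s, by simp⟩ = θ ⟨s', by simp⟩}

/-- The map `ρ : S → S' = S \ {s'}` sending `s'` to `s` and fixing all other tasks. -/
noncomputable def mergeMap {S : Type*} (s s' : S) (hss' : s ≠ s') (x : S) : {y : S // y ≠ s'} :=
  if h : x = s' then ⟨s, hss'⟩ else ⟨x, h⟩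

/-- Replacing a constraint `(L, Θ)` by `(ρ(L), Θ')` with
`Θ' = {θ' : ρ(L) → U | θ' ∘ (ρ restricted to L) ∈ Θ}`. -/
def mergeConstraint {S U : Type*} (s s' : S) (hss' : s ≠ s') (c : Constraint S U) :
    Constraint {y : S // y ≠ s'} U where
  scope := mergeMap s s' hss' '' c.scope
  theta := {θ' | (fun x : c.scope =>
      θ' ⟨mergeMap s s' hss' ↑x, Set.mem_image_of_mem _ x.2⟩) ∈ c.theta}

/-- The merged authorization lists: `A'(s) = A(s) ∩ A(s')` and `A'(t) = A(t)` for
every other task `t ≠ s`. -/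
noncomputable def mergeAuth {S U : Type*} (s s' : S) (A : S → Set U) (t : {y : S // y ≠ s'}) : Set U :=
  if (t : S) = s then A s ∩ A s' else A ↑t

@[simp]
lemma mergeMap_self {S : Type*} (s s' : S) (hss' : s ≠ s') :
    mergeMap s s' hss' s' = ⟨s, hss'⟩ := by
  simp [mergeMap]

lemma mergeMap_of_ne {S : Type*} (s s' : S) (hss' : s ≠ s') {x : S} (hx : x ≠ s') :
    mergeMap s s' hss' x = ⟨x, hx⟩ := by
  simp [mergeMap, hx]

lemma satisfies_eqConstraint {S U : Type*} (s s' : S) (π : S → U) :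
    Satisfies π (eqConstraint U s s') ↔ π s = π s' :=
  Iff.rfl

/-- A plan of the merged schema satisfies a merged constraint iff its pullback along the
merging map satisfies the original one. -/
lemma satisfies_mergeConstraint {S U : Type*} (s s' : S) (hss' : s ≠ s')
    (c : Constraint S U) (π' : {y : S // y ≠ s'} → U) :
    Satisfies π' (mergeConstraint s s' hss' c) ↔ Satisfies (π' ∘ mergeMap s s' hss') c :=
  Iff.rfl

/-- A plan of the merged schema is authorized iff its pullback is. -/
lemma forall_mem_mergeAuth {S U : Type*} (s s' : S) (hss' : s ≠ s') (A : S → Set U)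
    (π' : {y : S // y ≠ s'} → U) :
    (∀ t, π' t ∈ mergeAuth s s' A t) ↔ ∀ x, (π' ∘ mergeMap s s' hss') x ∈ A x := by
  constructor
  · intro h x
    by_cases hx : x = s'
    · subst hx
      have hs := h ⟨s, hss'⟩
      simp only [mergeAuth, if_true] at hs
      simpa using hs.2
    · have ht := h ⟨x, hx⟩
      rw [Function.comp_apply, mergeMap_of_ne s s' hss' hx]
      by_cases hxs : x = s
      · subst hxs
        simp only [mergeAuth, if_true] at ht
        exact ht.1
      · simpa [mergeAuth, hxs] using ht
  · rintro h ⟨t, ht⟩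
    have h₁ := h t
    rw [Function.comp_apply, mergeMap_of_ne s s' hss' ht] at h₁
    by_cases hts : t = s
    · subst hts
      have h₂ := h s'
      rw [Function.comp_apply, mergeMap_self] at h₂
      simpa [mergeAuth] using And.intro h₁ h₂
    · simpa [mergeAuth, hts] using h₁

/-- A plan taking the same value at `s` and `s'` is the pullback of its restriction. -/
lemma restrict_comp_mergeMap {S U : Type*} (s s' : S) (hss' : s ≠ s') (π : S → U)
    (h : π s = π s') :
    (fun t : {y : S // y ≠ s'} => π t) ∘ mergeMap s s' hss' = π := by
  funext x
  by_cases hx : x = s'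
  · subst hx
    simpa using h
  · simp [mergeMap_of_ne s s' hss' hx]

/-- A plan of the merged schema is valid iff its pullback is valid. -/
lemma validPlan_merge_iff {S U : Type*} (s s' : S) (hss' : s ≠ s')
    (A : S → Set U) (C : Set (Constraint S U)) (π' : {y : S // y ≠ s'} → U) :
    ValidPlan (mergeAuth s s' A)
        (mergeConstraint s s' hss' '' (C \ {eqConstraint U s s'})) π' ↔
      ValidPlan A C (π' ∘ mergeMap s s' hss') := by
  refine and_congr (forall_mem_mergeAuth s s' hss' A π') ?_
  rw [Set.forall_mem_image]
  constructor
  · intro h c hc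
    by_cases hce : c = eqConstraint U s s'
    · rw [hce, satisfies_eqConstraint]
      simp [mergeMap_of_ne s s' hss' hss']
    · exact (satisfies_mergeConstraint s s' hss' c π').1 (h ⟨hc, hce⟩)
  · intro h c hc
    exact (satisfies_mergeConstraint s s' hss' c π').2 (h c hc.1)

/-- Lemma 4.2 of the paper: merging two tasks forced equal by the equality constraint.
If the schema `(S, U, A, C)` contains the equality constraint on distinct tasks `s, s'`,
then it has a valid complete plan iff the merged schema—with task set `S \ {s'}`,
authorization lists `mergeAuth`, and constraints obtained from `C \ {c_eq}` by
replacing every constraint `(L, Θ)` by `(ρ(L), Θ')`—has a valid complete plan. -/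
theorem stmt_6 {S U : Type*} (s s' : S) (hss' : s ≠ s')
    (A : S → Set U) (C : Set (Constraint S U))
    (hC : eqConstraint U s s' ∈ C) :
    (∃ π : S → U, ValidPlan A C π) ↔
      (∃ π' : {y : S // y ≠ s'} → U,
        ValidPlan (mergeAuth s s' A)
          (mergeConstraint s s' hss' '' (C \ {eqConstraint U s s'})) π') := by
  constructor
  · rintro ⟨π, hπ⟩
    refine ⟨fun t => π t, (validPlan_merge_iff s s' hss' A C _).2 ?_⟩
    rwa [restrict_comp_mergeMap s s' hss' π
      ((satisfies_eqConstraint s s' π).1 (hπ.2 _ hC))]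
  · rintro ⟨π', hπ'⟩
    exact ⟨_, (validPlan_merge_iff s s' hss' A C π').1 hπ'⟩

end WSP
end

section
/- Let L be a finite nonempty set and let E be a family of subsets of L with ∅ ∈ E and containing at least one nonempty set, such that: (a) every nonempty T ∈ E is a block of some partition of L all of whose blocks belong to E; and (b) for every partition P of L all of whose blocks belong to E and every two distinct blocks T, T' of P, the union T ∪ T' belongs to E. Then for every T ∈ E, the complement L \ T belongs to E. -/
/-- A partition of (all of) `L` all of whose blocks belong to `E`: the blocks are
nonempty, pairwise disjoint, cover `L`, and each belongs to `E`. -/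
def IsEligPartition {L : Type*} (E : Set (Set L)) (P : Set (Set L)) : Prop :=
  (∀ B ∈ P, B.Nonempty) ∧
  (∀ B ∈ P, ∀ B' ∈ P, B ≠ B' → B ∩ B' = ∅) ∧
  ⋃₀ P = Set.univ ∧
  ∀ B ∈ P, B ∈ E

/-- Merging a nonempty subfamily of blocks whose union is in `E` yields another partition into
members of `E`. -/
theorem IsEligPartition.merge {L : Type*} {E P S : Set (Set L)} (hP : IsEligPartition E P)
    (hS : S ⊆ P) (hne : S.Nonempty) (hE : ⋃₀ S ∈ E) :
    IsEligPartition E (insert (⋃₀ S) (P \ S)) := by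
  obtain ⟨hnon, hdisj, hcover, hmem⟩ := hP
  have hdisjS : ∀ B ∈ P \ S, ⋃₀ S ∩ B = ∅ := by
    rintro B ⟨hBP, hBS⟩
    rw [← Set.disjoint_iff_inter_eq_empty, Set.disjoint_sUnion_left]
    intro C hC
    rw [Set.disjoint_iff_inter_eq_empty]
    exact hdisj C (hS hC) B hBP fun h => hBS (h ▸ hC)
  refine ⟨?_, ?_, ?_, ?_⟩
  · rintro B (rfl | hB)
    · obtain ⟨C, hC⟩ := hne
      exact (hnon C (hS hC)).mono (Set.subset_sUnion_of_mem hC)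
    · exact hnon B hB.1
  · rintro B (rfl | hB) B' (rfl | hB') hBB'
    · exact absurd rfl hBB'
    · exact hdisjS B' hB'
    · rw [Set.inter_comm]
      exact hdisjS B hB
    · exact hdisj B hB.1 B' hB'.1 hBB'
  · rw [Set.sUnion_insert, ← Set.sUnion_union, Set.union_sdiff_cancel hS, hcover]
  · rintro B (rfl | hB)
    · exact hE
    · exact hmem B hB.1

/-- If unions of two distinct blocks of partitions into members of `E` stay in `E`, then so do
unions of finite subfamilies of blocks. -/
theorem IsEligPartition.sUnion_mem {L : Type*} {E P S : Set (Set L)} (hempty : ∅ ∈ E)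
    (hb : ∀ P, IsEligPartition E P → ∀ T ∈ P, ∀ T' ∈ P, T ≠ T' → T ∪ T' ∈ E)
    (hP : IsEligPartition E P) (hfin : S.Finite) (hS : S ⊆ P) : ⋃₀ S ∈ E := by
  induction S, hfin using Set.Finite.induction_on with
  | empty => simpa using hempty
  | @insert B S hBS _ ih =>
    obtain ⟨hBP, hSP⟩ := Set.insert_subset_iff.mp hS
    rw [Set.sUnion_insert]
    rcases S.eq_empty_or_nonempty with rfl | hne
    · simpa using hP.2.2.2 B hBP
    · refine hb _ (hP.merge hSP hne (ih hSP)) B (Or.inr ⟨hBP, hBS⟩) _ (Or.inl rfl) ?_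
      intro hBU
      obtain ⟨x, hx⟩ := hP.1 B hBP
      obtain ⟨C, hC, hxC⟩ := hBU ▸ hx
      have hBC := hP.2.1 B hBP C (hSP hC) fun h => hBS (h ▸ hC)
      exact Set.notMem_empty x (hBC ▸ ⟨hx, hxC⟩)

/-- The claim from the second case of the proof of Lemma 4.7 of the paper: let `L` be a
finite nonempty set and `E` a family of subsets of `L` with `∅ ∈ E` and containing some
nonempty set, such that (a) every nonempty `T ∈ E` is a block of some partition of `L`
all of whose blocks belong to `E`, and (b) in any such partition, the union of any two
distinct blocks belongs to `E`. Then `E` is closed under complementation in `L`. -/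
theorem stmt_7 {L : Type*} [Fintype L] [Nonempty L] (E : Set (Set L))
    (hempty : ∅ ∈ E) (hnonempty : ∃ T ∈ E, T.Nonempty)
    (ha : ∀ T ∈ E, T.Nonempty → ∃ P, IsEligPartition E P ∧ T ∈ P)
    (hb : ∀ P, IsEligPartition E P → ∀ T ∈ P, ∀ T' ∈ P, T ≠ T' → T ∪ T' ∈ E) :
    ∀ T ∈ E, Tᶜ ∈ E := by
  intro T hT
  rcases T.eq_empty_or_nonempty with rfl | hTne
  · obtain ⟨U, hU, hUne⟩ := hnonempty
    obtain ⟨P, hP, -⟩ := ha U hU hUne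
    rw [Set.compl_empty, ← hP.2.2.1]
    exact hP.sUnion_mem hempty hb P.toFinite subset_rfl
  · obtain ⟨P, hP, hTP⟩ := ha T hT hTne
    have hcompl : Tᶜ = ⋃₀ (P \ {T}) := by
      apply Set.Subset.antisymm
      · intro x hx
        obtain ⟨B, hB, hxB⟩ : x ∈ ⋃₀ P := hP.2.2.1 ▸ Set.mem_univ x
        exact ⟨B, ⟨hB, fun h => hx (h ▸ hxB)⟩, hxB⟩
      · rintro x ⟨B, ⟨hB, hBT⟩, hxB⟩ hxT
        exact Set.notMem_empty x (hP.2.1 B hB T hTP hBT ▸ ⟨hxB, hxT⟩)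
    rw [hcompl]
    exact hP.sUnion_mem hempty hb (P \ {T}).toFinite Set.sdiff_subset
end

section
/- Let s_1, s_2, s_3, s_4 be four distinct tasks, L = {s_1, s_2, s_3, s_4}, and let U be a set of users with at least 4 elements. Let Θ be the set of all functions θ : L → U such that there exist i ∈ {1,2} and j ∈ {3,4} with θ(s_i) = θ(s_j), and let c = (L, Θ). Then every singleton {s_i}, i ∈ {1,2,3,4}, is c-eligible, yet for any four pairwise distinct users u_1, u_2, u_3, u_4 the plan assigning s_i to u_i does not lie in Θ. Consequently, c is not regular. -/
/-- A set `T ⊆ L` is eligible for the constraint `(L, Θ)` if some `θ ∈ Θ` has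
`θ⁻¹(u) = T` for some user `u`. -/
def Eligible {L U : Type*} (Θ : Set (L → U)) (T : Set L) : Prop :=
  ∃ θ ∈ Θ, ∃ u : U, θ ⁻¹' {u} = T

/-- A constraint `(L, Θ)` is regular if for every partition `L_1, …, L_p` of `L` into
eligible (nonempty, pairwise disjoint, covering) blocks and every choice of pairwise
distinct users `u_1, …, u_p`, the plan assigning every task of `L_i` to `u_i` lies
in `Θ`. -/
def Regular {L U : Type*} (Θ : Set (L → U)) : Prop :=
  ∀ (p : ℕ) (B : Fin p → Set L) (u : Fin p → U) (π : L → U),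
    (∀ i, (B i).Nonempty) →
    (Pairwise fun i j => Disjoint (B i) (B j)) →
    (⋃ i, B i) = Set.univ →
    (∀ i, Eligible Θ (B i)) →
    Function.Injective u →
    (∀ i, ∀ x ∈ B i, π x = u i) →
    π ∈ Θ

/-- The constraint `(=, {s₁,s₂}, {s₃,s₄})`: the set of plans `θ` such that
`θ(s_i) = θ(s_j)` for some `i ∈ {1,2}` and `j ∈ {3,4}`. -/
def eqTTTheta {S U : Type*} (s₁ s₂ s₃ s₄ : S) : Set (S → U) :=
  {θ | θ s₁ = θ s₃ ∨ θ s₁ = θ s₄ ∨ θ s₂ = θ s₃ ∨ θ s₂ = θ s₄}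

/-- A singleton is eligible as soon as some plan that is constant off it is allowed. -/
theorem eligible_singleton_of_update_const {L U : Type*} [DecidableEq L] {Θ : Set (L → U)}
    {s : L} {a b : U} (hab : a ≠ b) (h : Function.update (fun _ => b) s a ∈ Θ) :
    Eligible Θ {s} := by
  refine ⟨_, h, a, ?_⟩
  ext x
  by_cases hx : x = s <;> simp [hx, hab.symm]

/-- If all singletons are eligible for a regular constraint on a finite scope, then every
injective plan is allowed. -/
theorem Regular.mem_of_injective {L U : Type*} {Θ : Set (L → U)} (hΘ : Regular Θ) {p : ℕ}
    (e : Fin p ≃ L) (hs : ∀ x, Eligible Θ {x}) {π : L → U} (hπ : Function.Injective π) :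
    π ∈ Θ := by
  refine hΘ p (fun i => {e i}) (π ∘ e) π (fun i => Set.singleton_nonempty _) ?_ ?_
    (fun i => hs _) (hπ.comp e.injective) ?_
  · intro i j hij
    simpa using hij
  · ext x
    simp
  · rintro i x rfl
    rfl

/-- The example from Section 2 of the paper showing that `(=, T, T')` is in general not
regular. Here the type `S` plays the role of the scope `L = {s₁, s₂, s₃, s₄}`, with
`s₁, s₂, s₃, s₄` pairwise distinct and exhausting `S`, and `U` has at least 4 users.
Every singleton `{s_i}` is eligible, yet any plan assigning `s₁, s₂, s₃, s₄` to four
pairwise distinct users is not in `Θ`; consequently the constraint is not regular. -/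
theorem stmt_9 {S U : Type*} (s₁ s₂ s₃ s₄ : S)
    (h12 : s₁ ≠ s₂) (h13 : s₁ ≠ s₃) (h14 : s₁ ≠ s₄)
    (h23 : s₂ ≠ s₃) (h24 : s₂ ≠ s₄) (h34 : s₃ ≠ s₄)
    (hcover : ∀ x : S, x = s₁ ∨ x = s₂ ∨ x = s₃ ∨ x = s₄)
    (hU : ∃ f : Fin 4 → U, Function.Injective f) :
    (Eligible (eqTTTheta (U := U) s₁ s₂ s₃ s₄) {s₁} ∧
      Eligible (eqTTTheta (U := U) s₁ s₂ s₃ s₄) {s₂} ∧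
      Eligible (eqTTTheta (U := U) s₁ s₂ s₃ s₄) {s₃} ∧
      Eligible (eqTTTheta (U := U) s₁ s₂ s₃ s₄) {s₄}) ∧
    (∀ u₁ u₂ u₃ u₄ : U, u₁ ≠ u₂ → u₁ ≠ u₃ → u₁ ≠ u₄ → u₂ ≠ u₃ → u₂ ≠ u₄ → u₃ ≠ u₄ →
      ∀ π : S → U, π s₁ = u₁ → π s₂ = u₂ → π s₃ = u₃ → π s₄ = u₄ →
        π ∉ eqTTTheta (U := U) s₁ s₂ s₃ s₄) ∧
    ¬ Regular (eqTTTheta (U := U) s₁ s₂ s₃ s₄) := by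
  classical
  obtain ⟨f, hf⟩ := hU
  have h01 : f 0 ≠ f 1 := hf.ne (by decide)
  have e₁ : Eligible (eqTTTheta (U := U) s₁ s₂ s₃ s₄) {s₁} :=
    eligible_singleton_of_update_const h01 (by simp [eqTTTheta, *, Ne.symm])
  have e₂ : Eligible (eqTTTheta (U := U) s₁ s₂ s₃ s₄) {s₂} :=
    eligible_singleton_of_update_const h01 (by simp [eqTTTheta, *, Ne.symm])
  have e₃ : Eligible (eqTTTheta (U := U) s₁ s₂ s₃ s₄) {s₃} :=
    eligible_singleton_of_update_const h01 (by simp [eqTTTheta, *, Ne.symm])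
  have e₄ : Eligible (eqTTTheta (U := U) s₁ s₂ s₃ s₄) {s₄} :=
    eligible_singleton_of_update_const h01 (by simp [eqTTTheta, *, Ne.symm])
  refine ⟨⟨e₁, e₂, e₃, e₄⟩, ?_, fun hreg => ?_⟩
  · rintro _ _ _ _ - n13 n14 n23 n24 - π rfl rfl rfl rfl
    simp [eqTTTheta, *]
  · have hbij : Function.Bijective ![s₁, s₂, s₃, s₄] := by
      refine ⟨fun i j hij => ?_, fun x => ?_⟩
      · fin_cases i <;> fin_cases j <;> simp_all
      · rcases hcover x with rfl | rfl | rfl | rfl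
        exacts [⟨0, rfl⟩, ⟨1, rfl⟩, ⟨2, rfl⟩, ⟨3, rfl⟩]
    let e : Fin 4 ≃ S := Equiv.ofBijective _ hbij
    have hinj : Function.Injective (f ∘ e.symm) := hf.comp e.symm.injective
    have hmem := hreg.mem_of_injective e
      (fun x => by rcases hcover x with rfl | rfl | rfl | rfl <;> assumption) hinj
    rcases hmem with h | h | h | h
    exacts [h13 (hinj h), h14 (hinj h), h23 (hinj h), h24 (hinj h)]
end

section
/- Let U be a finite set of users, L a set of tasks, and c = (L, Θ) a user-independent constraint, i.e., for every θ ∈ Θ and every permutation ψ of U, the composition ψ ∘ θ lies in Θ. Let π, π' : L → U be two plans inducing the same partition of L, i.e., for all s, t ∈ L, π(s) = π(t) if and only if π'(s) = π'(t). Then π ∈ Θ if and only if π' ∈ Θ. -/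
/-- Two maps into a finite type with the same kernel differ by a permutation of the codomain. -/
theorem exists_perm_apply_eq_of_eq_iff {L U : Type*} [Finite U] {f g : L → U}
    (h : ∀ s t : L, f s = f t ↔ g s = g t) :
    ∃ σ : Equiv.Perm U, ∀ s, σ (f s) = g s := by
  let g' : Quotient (Setoid.ker f) → U := Quotient.lift g fun s t hst => (h s t).1 hst
  have hg' : Function.Injective g' := by
    rintro ⟨s⟩ ⟨t⟩ hst
    exact Quotient.sound ((h s t).2 hst)
  have : Finite (Quotient (Setoid.ker f)) := Finite.of_injective g' hg'
  obtain ⟨σ, hσ⟩ := Equiv.Perm.exists_extending_pair _ g' (Setoid.kerLift_injective f) hg'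
  exact ⟨σ, fun s => hσ (Quotient.mk _ s)⟩

/-- The claim from Section 2 of the paper that a user-independent constraint is
characterized on the level of partitions of its scope: if `Θ` is closed under
post-composition with every permutation of the finite user set `U`, and the plans
`π, π' : L → U` induce the same partition of `L`, then `π ∈ Θ ↔ π' ∈ Θ`. -/
theorem stmt_11 {L U : Type*} [Fintype U] (Θ : Set (L → U))
    (hui : ∀ θ ∈ Θ, ∀ ψ : Equiv.Perm U, (fun s => ψ (θ s)) ∈ Θ)
    (π π' : L → U)
    (hpart : ∀ s t : L, π s = π t ↔ π' s = π' t) :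
    π ∈ Θ ↔ π' ∈ Θ := by
  have transfer : ∀ {f g : L → U}, (∀ s t, f s = f t ↔ g s = g t) → f ∈ Θ → g ∈ Θ := by
    intro f g h hf
    obtain ⟨σ, hσ⟩ := exists_perm_apply_eq_of_eq_iff h
    simpa only [hσ] using hui f hf σ
  exact ⟨transfer hpart, transfer fun s t => (hpart s t).symm⟩
end

section
/- Let V be a set and P : V × V × V → Prop a predicate such that P(a,b,c) holds whenever a = b and a ≠ c, and P(a,b,c) holds whenever a = c and a ≠ b. Let ℓ ≥ 2, let v_1, …, v_ℓ ∈ V be pairwise distinct, let t ∈ {1,…,ℓ}, and define f : {2,…,ℓ} → V by f(j) = v_1 if j < t and f(j) = v_t if j ≥ t. Then P(f(2), v_1, v_2) holds, and P(f(j), f(j−1), v_j) holds for every j with 3 ≤ j ≤ ℓ. -/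
/-- The verification in the forward direction of the proof of Lemma 3.2 of the paper:
if the ternary predicate `P` holds whenever exactly the first and second, or exactly
the first and third, arguments coincide, the values `v 1, …, v ℓ` are pairwise distinct,
`t ∈ {1,…,ℓ}`, and `f j = v 1` for `j < t` and `f j = v t` for `j ≥ t`, then
`P (f 2) (v 1) (v 2)` holds and `P (f j) (f (j-1)) (v j)` holds for all `3 ≤ j ≤ ℓ`. -/
theorem stmt_14 {V : Type*} (P : V → V → V → Prop)
    (hP1 : ∀ a b c : V, a = b → a ≠ c → P a b c)
    (hP2 : ∀ a b c : V, a = c → a ≠ b → P a b c)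
    (ℓ : ℕ) (hℓ : 2 ≤ ℓ) (v : ℕ → V)
    (hv : ∀ i ∈ Finset.Icc 1 ℓ, ∀ j ∈ Finset.Icc 1 ℓ, i ≠ j → v i ≠ v j)
    (t : ℕ) (ht : t ∈ Finset.Icc 1 ℓ)
    (f : ℕ → V) (hf : ∀ j : ℕ, f j = if j < t then v 1 else v t) :
    P (f 2) (v 1) (v 2) ∧ ∀ j : ℕ, 3 ≤ j → j ≤ ℓ → P (f j) (f (j - 1)) (v j) := by
  obtain ⟨ht1, htℓ⟩ := Finset.mem_Icc.mp ht
  have hne : ∀ i j, 1 ≤ i → i ≤ ℓ → 1 ≤ j → j ≤ ℓ → i ≠ j → v i ≠ v j :=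
    fun i j hi hi' hj hj' =>
      hv i (Finset.mem_Icc.mpr ⟨hi, hi'⟩) j (Finset.mem_Icc.mpr ⟨hj, hj'⟩)
  have step : ∀ j, 2 ≤ j → j ≤ ℓ → P (f j) (f (j - 1)) (v j) := by
    intro j hj hjℓ
    rw [hf j, hf (j - 1)]
    rcases lt_trichotomy j t with h | rfl | h
    · rw [if_pos h, if_pos (by omega)]
      exact hP1 _ _ _ rfl (hne 1 j le_rfl (by omega) (by omega) hjℓ (by omega))
    · rw [if_neg (lt_irrefl j), if_pos (by omega)]
      exact hP2 _ _ _ rfl (hne j 1 ht1 hjℓ le_rfl (by omega) (by omega))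
    · rw [if_neg (by omega), if_neg (by omega)]
      exact hP1 _ _ _ rfl (hne t j ht1 htℓ (by omega) hjℓ (by omega))
  have hf1 : f 1 = v 1 := by
    rw [hf]
    split_ifs with h
    · rfl
    · rw [show t = 1 by omega]
  exact ⟨hf1 ▸ step 2 le_rfl hℓ, fun j hj => step j (by omega)⟩
end
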